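/- arXiv:2405.20054 — 2 statements merged into one kernel-verified Lean document; each statement's English description precedes it below -/
import Mathlib

section
/- (Ferguson's pairing property.) Let S be a finite nonempty set of positive integers and let a = min S. Then for every natural number n, the subtraction game on S satisfies G_S(n) = 1 if and only if n ≥ a and G_S(n − a) = 0. -/
/-- Nim-value (Sprague–Grundy value) of the subtraction game on `S`:
`subG S n = mex { subG S (n - s) : s ∈ S, s ≤ n }` (moves are positive). -/
noncomputable def subG (S : Finset ℕ) : ℕ → ℕ
  | n => sInf {k : ℕ | ∀ s ∈ S, ∀ (hs : 0 < s) (hn : s ≤ n), subG S (n - s) ≠ k}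
  decreasing_by exact Nat.sub_lt (Nat.lt_of_lt_of_le hs hn) hs

theorem subG_eq_sInf (S : Finset ℕ) (n : ℕ) :
    subG S n = sInf {k : ℕ | ∀ s ∈ S, 0 < s → s ≤ n → subG S (n - s) ≠ k} := by
  rw [subG]

theorem subG_sub_ne {S : Finset ℕ} {n s : ℕ} (hs : s ∈ S) (hs0 : 0 < s) (hsn : s ≤ n) :
    subG S (n - s) ≠ subG S n := by
  have hne : {k : ℕ | ∀ s ∈ S, 0 < s → s ≤ n → subG S (n - s) ≠ k}.Nonempty := by
    obtain ⟨k, hk⟩ := Infinite.exists_notMem_finset (S.image fun s => subG S (n - s))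
    exact ⟨k, fun s hs _ _ h => hk (Finset.mem_image.mpr ⟨s, hs, h⟩)⟩
  have h := Nat.sInf_mem hne
  rw [← subG_eq_sInf] at h
  exact h s hs hs0 hsn

theorem exists_subG_sub_eq {S : Finset ℕ} {n k : ℕ} (hk : k < subG S n) :
    ∃ s ∈ S, 0 < s ∧ s ≤ n ∧ subG S (n - s) = k := by
  rw [subG_eq_sInf] at hk
  simpa using Nat.notMem_of_lt_sInf hk

/-- Ferguson's pairing property: with `a = min S`, we have
`G_S(n) = 1` iff `n ≥ a` and `G_S(n - a) = 0`. -/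
theorem ferguson_pairing (S : Finset ℕ) (hne : S.Nonempty) (hpos : ∀ s ∈ S, 0 < s) :
    ∀ n : ℕ, subG S n = 1 ↔ S.min' hne ≤ n ∧ subG S (n - S.min' hne) = 0 := by
  intro n
  have ha := S.min'_mem hne
  have hle : ∀ s ∈ S, S.min' hne ≤ s := fun s hs => S.min'_le s hs
  generalize S.min' hne = a at ha hle ⊢
  have ha0 := hpos a ha
  induction n using Nat.strong_induction_on with
  | _ n ih =>
    constructor
    · intro h
      obtain ⟨s, hs, -, hsn, -⟩ := exists_subG_sub_eq (h ▸ Nat.zero_lt_one : 0 < subG S n)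
      have han : a ≤ n := (hle s hs).trans hsn
      refine ⟨han, ?_⟩
      by_contra h0
      obtain ⟨t, ht, ht0, htn, h1⟩ := exists_subG_sub_eq (Nat.pos_of_ne_zero h0)
      rw [Nat.sub_right_comm] at h1
      have h2 := (ih (n - t) (by omega)).mpr ⟨by omega, h1⟩
      exact subG_sub_ne ht ht0 (by omega) (h2.trans h.symm)
    · rintro ⟨han, h0⟩
      have hn0 := subG_sub_ne ha ha0 han
      by_contra h1
      obtain ⟨s, hs, hs0, hsn, h2⟩ := exists_subG_sub_eq (by omega : 1 < subG S n)
      obtain ⟨has, h3⟩ := (ih (n - s) (by omega)).mp h2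
      rw [Nat.sub_right_comm] at h3
      exact subG_sub_ne hs hs0 (by omega) (h3.trans h0.symm)
end

section
/- (Abuku–Suetsugu, four excluded moves.) Let a < b < c < d be positive integers and S = {a, b, c, d}. Suppose S is not of the exceptional form {a, b, a+b, a+2b} with b ≠ 2a (i.e. not (c = a + b and d = a + 2b and b ≠ 2a)), and not of the exceptional form {a, b, c, a+c} with b ≠ 2a and c ≠ 2a (i.e. not (d = a + c and b ≠ 2a and c ≠ 2a)). Then the nim-value sequence of all-but nim with FES set S is purely arithmetic periodic: there exist integers p > 0 and s > 0 such that G(n + p) = G(n) + s for all n ≥ 0. -/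
/-- Nim-value of all-but nim ("finite excluded subtraction") with FES set `S`:
`fesG S n = mex { fesG S (n - m) : 1 ≤ m ≤ n, m ∉ S }`. -/
noncomputable def fesG (S : Finset ℕ) : ℕ → ℕ
  | n => sInf {k : ℕ | ∀ (m : ℕ) (hm : 0 < m) (hn : m ≤ n), m ∉ S → fesG S (n - m) ≠ k}
  decreasing_by exact Nat.sub_lt (Nat.lt_of_lt_of_le hm hn) hm

theorem fesG_ne {S : Finset ℕ} {k n : ℕ} (hk : k < n) (h : n - k ∉ S) :
    fesG S k ≠ fesG S n := by
  have hne : {v : ℕ | ∀ m, 0 < m → m ≤ n → m ∉ S → fesG S (n - m) ≠ v}.Nonempty := by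
    obtain ⟨v, hv⟩ := Infinite.exists_notMem_finset
      ((Finset.range (n + 1)).image fun m => fesG S (n - m))
    refine ⟨v, fun m _ hm _ he => hv ?_⟩
    exact Finset.mem_image.2 ⟨m, Finset.mem_range.2 (by omega), he⟩
  have hmem := Nat.sInf_mem hne (n - k) (by omega) (by omega) h
  rw [show n - (n - k) = k by omega] at hmem
  conv_rhs => rw [fesG]
  exact hmem

theorem fesG_le {S : Finset ℕ} {n v : ℕ} (h : ∀ k < n, n - k ∉ S → fesG S k ≠ v) :
    fesG S n ≤ v := by
  rw [fesG]
  exact Nat.sInf_le fun m hm hn hmS =>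
    h (n - m) (by omega) (by rwa [show n - (n - m) = m by omega])

theorem sub_mem_of_fesG_eq {S : Finset ℕ} {k n : ℕ} (hk : k < n) (h : fesG S k = fesG S n) :
    n - k ∈ S := by
  by_contra hS
  exact fesG_ne hk hS h

theorem fesG_eq_of_le {S : Finset ℕ} {n v : ℕ} (hv : v ≤ fesG S n)
    (h : ∀ k < n, fesG S k = v → n - k ∈ S) : fesG S n = v :=
  le_antisymm (fesG_le fun k hk hS he => hS (h k hk he)) hv

/-- If the values below `s` are taken exactly on the initial segment `[0, p)`, then the nim-value
sequence is purely arithmetic periodic. -/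
theorem fesG_add_of_lt_iff {S : Finset ℕ} {p s : ℕ} (h : ∀ n, fesG S n < s ↔ n < p) (n : ℕ) :
    fesG S (n + p) = fesG S n + s := by
  induction n using Nat.strong_induction_on with
  | _ n ih =>
    have hge : ∀ m, s ≤ fesG S (m + p) := fun m => by
      have := h (m + p)
      omega
    apply le_antisymm
    · refine fesG_le fun k hk hS he => ?_
      have hkp : p ≤ k := by
        have := h k
        omega
      obtain ⟨j, rfl⟩ := Nat.exists_eq_add_of_le' hkp
      rw [ih j (by omega)] at he
      exact fesG_ne (S := S) (k := j) (n := n) (by omega)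
        (by rwa [show n + p - (j + p) = n - j by omega] at hS) (by omega)
    · have hle : fesG S n ≤ fesG S (n + p) - s := by
        refine fesG_le fun k hk hS he => ?_
        refine fesG_ne (S := S) (k := k + p) (n := n + p) (by omega)
          (by rwa [show n + p - (k + p) = n - k by omega]) ?_
        have := hge n
        rw [ih k hk]
        omega
      have := hge n
      omega

theorem exists_period_of_lt_iff {S : Finset ℕ} {p s : ℕ} (hp : 0 < p)
    (h : ∀ n, fesG S n < s ↔ n < p) :
    ∃ (p s : ℕ), 0 < p ∧ 0 < s ∧ ∀ n : ℕ, fesG S (n + p) = fesG S n + s :=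
  ⟨p, s, hp, ((h 0).2 hp).pos, fesG_add_of_lt_iff h⟩

/-- Periodicity when a longest arithmetic progression of difference `a = min S` in `S` starts
at `a`. -/
theorem exists_period_of_progression {S : Finset ℕ} {a l : ℕ} (ha : 0 < a)
    (hmin : ∀ m ∈ S, a ≤ m) (hmul : ∀ j, 0 < j → j ≤ l → j * a ∈ S)
    (hno : ∀ t, ∃ j ≤ l, t + j * a ∉ S) :
    ∃ (p s : ℕ), 0 < p ∧ 0 < s ∧ ∀ n : ℕ, fesG S (n + p) = fesG S n + s := by
  have hmod : ∀ n < (l + 1) * a, fesG S n = n % a := by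
    intro n
    induction n using Nat.strong_induction_on with
    | _ n ih =>
      intro hn
      have hdiv := Nat.div_add_mod n a
      have hr := Nat.mod_lt n ha
      refine fesG_eq_of_le ?_ ?_
      · by_contra! hlt
        have hkn : a * (n / a) + fesG S n < n := by omega
        have hk := ih _ hkn (by omega)
        rw [Nat.mul_add_mod, Nat.mod_eq_of_lt (by omega)] at hk
        have := hmin _ (sub_mem_of_fesG_eq hkn hk)
        omega
      · intro k hk he
        rw [ih k hk (by omega)] at he
        have hdvd : a ∣ n - k := (Nat.modEq_iff_dvd' hk.le).1 he
        obtain ⟨j, hj⟩ := hdvd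
        rw [hj, mul_comm]
        refine hmul j ?_ ?_
        · rcases Nat.eq_zero_or_pos j with rfl | h
          · simp at hj
            omega
          · exact h
        · by_contra! hlj
          have : (l + 1) * a ≤ j * a := Nat.mul_le_mul_right a hlj
          rw [mul_comm j a] at this
          omega
  refine exists_period_of_lt_iff (S := S) (p := (l + 1) * a) (s := a) (by positivity) fun n =>
    ⟨fun hlt => ?_, fun hlt => hmod n hlt ▸ Nat.mod_lt n ha⟩
  by_contra! hn
  have hexp : (l + 1) * a = l * a + a := by ring
  obtain ⟨j, hj, hjS⟩ := hno (n - fesG S n - l * a)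
  have hsplit : (l - j) * a + j * a = l * a := by rw [← add_mul, Nat.sub_add_cancel hj]
  have hk : fesG S ((l - j) * a + fesG S n) = fesG S n := by
    rw [hmod _ (by omega), Nat.mul_add_mod_self_right, Nat.mod_eq_of_lt hlt]
  have := sub_mem_of_fesG_eq (by omega) hk
  apply hjS
  convert this using 1
  omega

/-- The covered set `T` after the first tile: if `0` is uncovered, then `0`, `a + b` and one more
element are added, namely `a` if it is uncovered, and `b` otherwise. -/
def tileFill (a b : ℕ) (T : Set ℕ) : Set ℕ :=
  {j | j ∈ T ∨ (0 ∉ T ∧ (j = 0 ∨ j = a + b ∨ (a ∉ T ∧ j = a) ∨ (a ∈ T ∧ j = b)))}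

/-- The set of covered elements, relative to the current position, after moving on by one. -/
def tileStep (a b : ℕ) (T : Set ℕ) : Set ℕ :=
  {j | j + 1 ∈ tileFill a b T}

/-- The invariant satisfied by the sets of covered elements in a greedy tiling. -/
def TileState (a b : ℕ) (T : Set ℕ) : Prop :=
  (∀ j ∈ T, j < a + b) ∧ ∀ j, j + b ∈ T → j ∈ T

theorem TileState.step {a b : ℕ} (ha : 0 < a) (hab : a < b) {T : Set ℕ} (hT : TileState a b T) :
    TileState a b (tileStep a b T) := by
  obtain ⟨h1, h2⟩ := hT
  constructor
  · rintro j (hj | ⟨_, hj⟩)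
    · have := h1 _ hj
      omega
    · omega
  · rintro j (hj | ⟨h0, hj⟩)
    · exact Or.inl (h2 (j + 1) (by rwa [show j + 1 + b = j + b + 1 by omega]))
    · rcases hj with hj | hj | ⟨_, hj⟩ | ⟨_, hj⟩
      · omega
      · have hja : j + 1 = a := by omega
        by_cases haT : a ∈ T
        · exact Or.inl (hja ▸ haT)
        · exact Or.inr ⟨h0, Or.inr (Or.inr (Or.inl ⟨haT, hja⟩))⟩
      · omega
      · omega

theorem TileState.mem_iff {a b : ℕ} (ha : 0 < a) (hab : a < b) {T : Set ℕ}
    (hT : TileState a b T) (j : ℕ) :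
    j ∈ T ↔ j ∈ tileFill a b T ∧ (a + b ∈ tileFill a b T →
      j ≠ 0 ∧ j ≠ a + b ∧ (b ∈ tileFill a b T → j ≠ b) ∧ (b ∉ tileFill a b T → j ≠ a)) := by
  obtain ⟨h1, h2⟩ := hT
  have hs : a + b ∉ T := fun h => lt_irrefl _ (h1 _ h)
  have hb : b ∈ T → 0 ∈ T := fun h => h2 0 (by simpa using h)
  simp only [tileFill, Set.mem_ofPred_eq]
  grind

theorem TileState.step_injective {a b : ℕ} (ha : 0 < a) (hab : a < b) {T U : Set ℕ}
    (hT : TileState a b T) (hU : TileState a b U) (h : tileStep a b T = tileStep a b U) :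
    T = U := by
  have hzero : ∀ V, 0 ∈ tileFill a b V := fun V => by
    by_cases h0 : 0 ∈ V
    · exact Or.inl h0
    · exact Or.inr ⟨h0, Or.inl rfl⟩
  have hfill : tileFill a b T = tileFill a b U := by
    ext j
    cases j with
    | zero => exact iff_of_true (hzero T) (hzero U)
    | succ j => exact Set.ext_iff.1 h j
  ext j
  rw [hT.mem_iff ha hab, hU.mem_iff ha hab, hfill]

theorem tileState_empty (a b : ℕ) : TileState a b ∅ := by
  simp [TileState]

theorem TileState.iterate {a b : ℕ} (ha : 0 < a) (hab : a < b) (x : ℕ) :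
    TileState a b ((tileStep a b)^[x] ∅) := by
  induction x with
  | zero => exact tileState_empty a b
  | succ x ih => exact Function.iterate_succ_apply' (tileStep a b) x ∅ ▸ ih.step ha hab

theorem exists_tileStep_iterate_eq_empty {a b : ℕ} (ha : 0 < a) (hab : a < b) :
    ∃ p > 0, (tileStep a b)^[p] ∅ = ∅ := by
  have hfin : {T | TileState a b T}.Finite :=
    (Set.finite_Iio (a + b)).finite_subsets.subset fun T hT j hj => hT.1 j hj
  obtain ⟨m, n, hlt, hmn⟩ : ∃ m n, m < n ∧ (tileStep a b)^[m] ∅ = (tileStep a b)^[n] ∅ := by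
    obtain ⟨m, -, n, -, hlt, h⟩ := Set.infinite_univ.exists_lt_map_eq_of_mapsTo
      (fun x _ => TileState.iterate ha hab x) hfin
    exact ⟨m, n, hlt, h⟩
  induction m generalizing n with
  | zero => exact ⟨n, hlt, hmn.symm⟩
  | succ m ih =>
    obtain ⟨k, rfl⟩ : ∃ k, n = k + 1 := ⟨n - 1, by omega⟩
    rw [Function.iterate_succ_apply', Function.iterate_succ_apply'] at hmn
    exact ih k (by omega) (TileState.step_injective ha hab (TileState.iterate ha hab m)
      (TileState.iterate ha hab k) hmn)

section Triple

variable {S : Finset ℕ} {a b : ℕ}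

/-- The class of nim-value `v` when all of `x`, `x + a` and `x + a + b` are uncovered. -/
theorem fesG_eq_iff_of_left (ha : 0 < a) (haS : a ∈ S) (hbS : b ∈ S)
    (habS : a + b ∈ S) (hgap : ∀ t ∈ S, t = a ∨ b ≤ t) (hab : a < b)
    (hshift : ∀ t ∈ S, t + a ∈ S → t = b) {x v : ℕ} (hlt : ∀ k < x, fesG S k < v)
    (hx : v ≤ fesG S x) (hxa : v ≤ fesG S (x + a)) (hxab : v ≤ fesG S (x + a + b)) (n : ℕ) :
    fesG S n = v ↔ n = x ∨ n = x + a ∨ n = x + a + b := by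
  have e1 : fesG S x = v := fesG_eq_of_le hx fun k hk he => absurd he (hlt k hk).ne
  have hdiff : ∀ {k m}, k < m → fesG S k = v → fesG S m = v → m - k ∈ S :=
    fun hkm hk hm => sub_mem_of_fesG_eq hkm (hk.trans hm.symm)
  have hmin : ∀ t ∈ S, a ≤ t := fun t ht => by
    have := hgap t ht
    omega
  have hge : ∀ k, fesG S k = v → x ≤ k := fun k hk => by
    by_contra! h
    exact (hlt k h).ne hk
  have hnear : ∀ k, x < k → fesG S k = v → x + a ≤ k := fun k hk he => by
    have := hmin _ (hdiff hk e1 he)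
    omega
  have e2 : fesG S (x + a) = v := by
    refine fesG_eq_of_le hxa fun k hk he => ?_
    have h1 := hge k he
    have h2 := hnear k
    obtain rfl : k = x := by
      by_contra h
      have := h2 (by omega) he
      omega
    simpa using haS
  have hfar : ∀ k, x + a < k → fesG S k = v → k = x + a + b := fun k hk he => by
    have h1 := hdiff hk e2 he
    have h2 := hdiff (by omega) e1 he
    have := hshift _ h1 (by rwa [show k - (x + a) + a = k - x by omega])
    omega
  have e3 : fesG S (x + a + b) = v := by
    refine fesG_eq_of_le hxab fun k hk he => ?_
    have h1 := hge k he
    have h2 := hnear k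
    have h3 := hfar k
    obtain rfl | rfl : k = x ∨ k = x + a := by
      by_contra! h
      have := h2 (by omega) he
      have := h3 (by omega) he
      omega
    · simpa [add_assoc] using habS
    · simpa using hbS
  refine ⟨fun he => ?_, by rintro (rfl | rfl | rfl) <;> assumption⟩
  have h1 := hge n he
  have h2 := hnear n
  have h3 := hfar n
  by_contra! h
  have := h2 (by omega) he
  exact h.2.2 (h3 (by omega) he)

/-- The class of nim-value `v` when `x`, `x + b` and `x + a + b` are uncovered, but `x + a` is
covered. -/
theorem fesG_eq_iff_of_right (ha : 0 < a) (haS : a ∈ S) (hbS : b ∈ S)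
    (habS : a + b ∈ S) (hgap : ∀ t ∈ S, t = a ∨ b ≤ t) (hab : a < b)
    (hshift : ∀ t ∈ S, t + a ∈ S → t = b) (hlast : a + 2 * b ∉ S) {x v : ℕ}
    (hlt : ∀ k < x, fesG S k < v) (hx : v ≤ fesG S x) (hxa : fesG S (x + a) < v)
    (hxb : v ≤ fesG S (x + b)) (hxab : v ≤ fesG S (x + a + b)) (n : ℕ) :
    fesG S n = v ↔ n = x ∨ n = x + b ∨ n = x + a + b := by
  have e1 : fesG S x = v := fesG_eq_of_le hx fun k hk he => absurd he (hlt k hk).ne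
  have hdiff : ∀ {k m}, k < m → fesG S k = v → fesG S m = v → m - k ∈ S :=
    fun hkm hk hm => sub_mem_of_fesG_eq hkm (hk.trans hm.symm)
  have hge : ∀ k, fesG S k = v → x ≤ k := fun k hk => by
    by_contra! h
    exact (hlt k h).ne hk
  have hnear : ∀ k, x < k → fesG S k = v → x + b ≤ k := fun k hk he => by
    rcases hgap _ (hdiff hk e1 he) with h | h
    · obtain rfl : k = x + a := by omega
      exact absurd he hxa.ne
    · omega
  have e2 : fesG S (x + b) = v := by
    refine fesG_eq_of_le hxb fun k hk he => ?_
    have h1 := hge k he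
    have h2 := hnear k
    obtain rfl : k = x := by
      by_contra h
      have := h2 (by omega) he
      omega
    simpa using hbS
  have hmid : ∀ k, x + b < k → fesG S k = v → x + a + b ≤ k := fun k hk he => by
    have := hgap _ (hdiff hk e2 he)
    omega
  have e3 : fesG S (x + a + b) = v := by
    refine fesG_eq_of_le hxab fun k hk he => ?_
    have h1 := hge k he
    have h2 := hnear k
    have h3 := hmid k
    obtain rfl | rfl : k = x ∨ k = x + b := by
      by_contra! h
      have := h2 (by omega) he
      have := h3 (by omega) he
      omega
    · simpa [add_assoc] using habS
    · rwa [show x + a + b - (x + b) = a by omega]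
  have hfar : ∀ k, x + a + b < k → fesG S k ≠ v := fun k hk he => by
    have h1 := hdiff hk e3 he
    have h2 := hdiff (by omega) e2 he
    have h3 := hdiff (by omega) e1 he
    have := hshift _ h1 (by rwa [show k - (x + a + b) + a = k - (x + b) by omega])
    exact hlast (by rwa [show a + 2 * b = k - x by omega])
  refine ⟨fun he => ?_, by rintro (rfl | rfl | rfl) <;> assumption⟩
  have h1 := hge n he
  have h2 := hnear n
  have h3 := hmid n
  have h4 := hfar n
  by_contra! h
  have := h2 (by omega) he
  have := h3 (by omega) he
  exact h4 (by omega) he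

/-- The nim-value classes tile `ℕ` by isometric copies of `{0, a, a + b}`. -/
theorem exists_fesG_lt_iff_tile (ha : 0 < a) (haS : a ∈ S) (hbS : b ∈ S)
    (habS : a + b ∈ S) (hgap : ∀ t ∈ S, t = a ∨ b ≤ t) (hab : a < b)
    (hshift : ∀ t ∈ S, t + a ∈ S → t = b) (hlast : a + 2 * b ∉ S) (x : ℕ) :
    ∃ v, ∀ n, fesG S n < v ↔ n < x ∨ ∃ j ∈ (tileStep a b)^[x] ∅, n = x + j := by
  induction x with
  | zero => exact ⟨0, by simp⟩
  | succ x ih =>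
    obtain ⟨v, hv⟩ := ih
    rw [Function.iterate_succ_apply']
    have hT := TileState.iterate ha hab x
    generalize (tileStep a b)^[x] ∅ = T at hv hT ⊢
    have hadd : ∀ j, fesG S (x + j) < v ↔ j ∈ T := fun j => by
      simp [hv]
    have hlt : ∀ k < x, fesG S k < v := fun k hk => (hv k).2 (Or.inl hk)
    have key : (∃ w, (∀ k < x, fesG S k < w) ∧ ∀ j, fesG S (x + j) < w ↔ j ∈ tileFill a b T) →
        ∃ w, ∀ n, fesG S n < w ↔ n < x + 1 ∨ ∃ j ∈ tileStep a b T, n = x + 1 + j := by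
      rintro ⟨w, hw, hw'⟩
      refine ⟨w, fun n => ?_⟩
      rcases lt_trichotomy n x with h | rfl | h
      · exact iff_of_true (hw n h) (Or.inl (by omega))
      · refine iff_of_true ((hw' 0).2 ?_) (Or.inl (by omega))
        by_cases h0 : 0 ∈ T
        · exact Or.inl h0
        · exact Or.inr ⟨h0, Or.inl rfl⟩
      · obtain ⟨j, rfl⟩ : ∃ j, n = x + (j + 1) := ⟨n - x - 1, by omega⟩
        rw [hw']
        refine ⟨fun hj => Or.inr ⟨j, hj, by omega⟩, ?_⟩
        rintro (hj | ⟨i, hi, hij⟩)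
        · omega
        · obtain rfl : j = i := by omega
          exact hi
    apply key
    by_cases h0 : 0 ∈ T
    · exact ⟨v, hlt, fun j => by simp [hadd, tileFill, h0]⟩
    have hs : a + b ∉ T := fun h => lt_irrefl _ (hT.1 _ h)
    have hb : b ∉ T := fun h => h0 (hT.2 0 (by simpa using h))
    have hx : v ≤ fesG S x := not_lt.1 fun h => h0 ((hadd 0).1 h)
    have hxb : v ≤ fesG S (x + b) := not_lt.1 fun h => hb ((hadd b).1 h)
    have hxab : v ≤ fesG S (x + a + b) := not_lt.1 fun h =>
      hs ((hadd (a + b)).1 (by rwa [← add_assoc]))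
    refine ⟨v + 1, fun k hk => (hlt k hk).trans (by omega), fun j => ?_⟩
    rw [Nat.lt_succ_iff, le_iff_lt_or_eq, hadd]
    by_cases haT : a ∈ T
    · rw [fesG_eq_iff_of_right ha haS hbS habS hgap hab hshift hlast hlt hx
        ((hadd a).2 haT) hxb hxab]
      simp only [tileFill, Set.mem_ofPred_eq]
      grind
    · rw [fesG_eq_iff_of_left ha haS hbS habS hgap hab hshift hlt hx
        (not_lt.1 fun h => haT ((hadd a).1 h)) hxab]
      simp only [tileFill, Set.mem_ofPred_eq]
      grind

theorem exists_period_of_triple (ha : 0 < a) (haS : a ∈ S) (hbS : b ∈ S)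
    (habS : a + b ∈ S) (hgap : ∀ t ∈ S, t = a ∨ b ≤ t) (hab : a < b)
    (hshift : ∀ t ∈ S, t + a ∈ S → t = b) (hlast : a + 2 * b ∉ S) :
    ∃ (p s : ℕ), 0 < p ∧ 0 < s ∧ ∀ n : ℕ, fesG S (n + p) = fesG S n + s := by
  obtain ⟨p, hp, hpT⟩ := exists_tileStep_iterate_eq_empty ha hab
  obtain ⟨v, hv⟩ := exists_fesG_lt_iff_tile ha haS hbS habS hgap hab hshift hlast p
  rw [hpT] at hv
  exact exists_period_of_lt_iff hp fun n => by simpa using hv n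

end Triple

/-- Abuku–Suetsugu, four excluded moves: all-but nim with FES set
`S = {a, b, c, d}`, `a < b < c < d`, is purely arithmetic periodic unless `S` is of
the form `{a, b, a+b, a+2b}` with `b ≠ 2a` or `{a, b, c, a+c}` with `b ≠ 2a, c ≠ 2a`. -/
theorem abuku_suetsugu_four (a b c d : ℕ) (ha : 0 < a) (hab : a < b) (hbc : b < c)
    (hcd : c < d)
    (hexc1 : ¬(c = a + b ∧ d = a + 2 * b ∧ b ≠ 2 * a))
    (hexc2 : ¬(d = a + c ∧ b ≠ 2 * a ∧ c ≠ 2 * a)) :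
    ∃ (p s : ℕ), 0 < p ∧ 0 < s ∧
      ∀ n : ℕ, fesG {a, b, c, d} (n + p) = fesG {a, b, c, d} n + s := by
  have mem : ∀ m, m ∈ ({a, b, c, d} : Finset ℕ) ↔ m = a ∨ m = b ∨ m = c ∨ m = d := by simp
  have hmin : ∀ m ∈ ({a, b, c, d} : Finset ℕ), a ≤ m := fun m hm => by
    rw [mem] at hm
    omega
  have progression : ∀ l, (∀ j, 0 < j → j ≤ l → j * a = a ∨ j * a = b ∨ j * a = c ∨ j * a = d) →
      (∀ t, ∃ j ≤ l, ¬(t + j * a = a ∨ t + j * a = b ∨ t + j * a = c ∨ t + j * a = d)) →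
      ∃ (p s : ℕ), 0 < p ∧ 0 < s ∧
        ∀ n : ℕ, fesG {a, b, c, d} (n + p) = fesG {a, b, c, d} n + s := fun l h1 h2 =>
    exists_period_of_progression (l := l) ha hmin (by simpa only [mem] using h1)
      (by simpa only [mem] using h2)
  by_cases h2 : b = 2 * a ∨ c = 2 * a ∨ d = 2 * a
  · by_cases h3 : c = 3 * a ∨ d = 3 * a
    · by_cases h4 : d = 4 * a
      · refine progression 4 (fun j h0 h => by interval_cases j <;> omega) fun t => ?_
        by_contra! h
        have := h 0; have := h 1; have := h 2; have := h 3; have := h 4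
        omega
      · refine progression 3 (fun j h0 h => by interval_cases j <;> omega) fun t => ?_
        by_contra! h
        have := h 0; have := h 1; have := h 2; have := h 3
        omega
    · refine progression 2 (fun j h0 h => by interval_cases j <;> omega) fun t => ?_
      by_contra! h
      have := h 0; have := h 1; have := h 2
      omega
  · by_cases h3 : c = a + b ∨ d = a + b
    · refine exists_period_of_triple (a := a) (b := b) ha ?_ ?_ ?_ ?_ hab ?_ ?_ <;>
        simp only [mem, true_or, or_true] <;> intros <;> omega
    · refine progression 1 (fun j h0 h => by interval_cases j; omega) fun t => ?_
      by_contra! h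
      have := h 0; have := h 1
      omega
end
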